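/- For every complex number z with |z| < 4/27, the series G(z) = Σ_{n≥0} C(3n,n)·(2/(n+1)) · zⁿ converges and equals B₃(z) + B₃(z)², where B₃(z) = Σ_{n≥0} C(3n+1,n)/(3n+1) · zⁿ. -/

import Mathlib

/-- The Fuss–Catalan generating function of order 3. -/
noncomputable def B₃ (z : ℂ) : ℂ :=
  ∑' n : ℕ, (Nat.choose (3 * n + 1) n : ℂ) / (3 * n + 1) * z ^ n

/-- Rothe–Hagen numbers `x/(x+3n) * C(x+3n,n)`, defined recursively. -/
def hagenA : ℕ → ℕ → ℕ
  | 0, _ => 1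
  | _ + 1, 0 => 0
  | n + 1, x + 1 => hagenA (n + 1) x + hagenA n (x + 3)
termination_by n x => (n, x)

theorem hagenA_zero (x : ℕ) : hagenA 0 x = 1 := by rw [hagenA]

theorem hagenA_succ_zero (n : ℕ) : hagenA (n + 1) 0 = 0 := by rw [hagenA]

theorem hagenA_succ_succ (n x : ℕ) :
    hagenA (n + 1) (x + 1) = hagenA (n + 1) x + hagenA n (x + 3) := by rw [hagenA]

theorem hagenA_closed (n : ℕ) : ∀ x : ℕ,
    (x + 3 * n) * hagenA n x = x * Nat.choose (x + 3 * n) n := by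
  induction n with
  | zero => intro x; simp [hagenA_zero]
  | succ n ihn =>
    intro x
    induction x with
    | zero => simp [hagenA_succ_zero]
    | succ x ihx =>
      rw [hagenA_succ_succ]
      have h2 := ihn (x + 3)
      have e1 : x + 3 + 3 * n = x + 3 * (n + 1) := by ring
      have e2 : x + 1 + 3 * (n + 1) = x + 3 * (n + 1) + 1 := by ring
      rw [e1] at h2
      rw [e2, Nat.choose_succ_succ]
      have h3 := Nat.choose_succ_right_eq (x + 3 * (n + 1)) n
      have e3 : x + 3 * (n + 1) - n = x + 2 * n + 3 := by omega
      rw [e3] at h3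
      generalize Nat.choose (x + 3 * (n + 1)) (n + 1) = C at *
      generalize Nat.choose (x + 3 * (n + 1)) n = D at *
      generalize hagenA (n + 1) x = P at *
      generalize hagenA n (x + 3) = Q at *
      have hN : (x + 3 * (n + 1)) ≠ 0 := by omega
      apply Nat.eq_of_mul_eq_mul_left (Nat.pos_of_ne_zero hN)
      zify at *
      linear_combination ((x : ℤ) + 3 * (n + 1) + 1) * (ihx + h2) - 3 * h3

theorem hagenA_conv (n : ℕ) : ∀ x y : ℕ,
    ∑ p ∈ Finset.HasAntidiagonal.antidiagonal n, hagenA p.1 x * hagenA p.2 y = hagenA n (x + y) := by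
  induction n with
  | zero => intro x y; simp [hagenA_zero]
  | succ n ihn =>
    intro x y
    induction x with
    | zero =>
      rw [Finset.Nat.sum_antidiagonal_succ]
      simp [hagenA_succ_zero, hagenA_zero]
    | succ x ihx =>
      rw [Finset.Nat.sum_antidiagonal_succ] at ihx ⊢
      have e : x + 1 + y = x + y + 1 := by ring
      have e' : x + y + 3 = x + 3 + y := by ring
      rw [e, hagenA_succ_succ, ← ihx, e', ← ihn]
      simp only [hagenA_succ_succ, add_mul, Finset.sum_add_distrib, hagenA_zero]
      ring

theorem choose_bound (n : ℕ) : (Nat.choose (3 * n) n : ℝ) ≤ (27 / 4) ^ n := by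
  have h : Nat.choose (3 * n) n * 4 ^ n ≤ 27 ^ n := by
    have h1 := add_pow 1 2 (3 * n)
    have h2 := Finset.single_le_sum
      (f := fun m => 1 ^ m * 2 ^ (3 * n - m) * Nat.choose (3 * n) m)
      (s := Finset.range (3 * n + 1)) (fun i _ => Nat.zero_le _)
      (Finset.mem_range.2 (by omega : n < 3 * n + 1))
    simp only [Nat.cast_id] at h1
    rw [← h1] at h2
    have e : 3 * n - n = 2 * n := by omega
    rw [e, pow_mul, pow_mul] at h2
    norm_num at h2
    linarith
  rw [div_pow, le_div_iff₀ (by positivity)]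
  exact_mod_cast h

theorem hagenA_one (n : ℕ) : (2 * n + 1) * hagenA n 1 = Nat.choose (3 * n) n := by
  have h := hagenA_closed n 1
  have h2 := Nat.choose_mul_succ_eq (3 * n) n
  have e : 3 * n + 1 - n = 2 * n + 1 := by omega
  rw [e] at h2
  rw [add_comm 1 (3 * n)] at h
  apply Nat.eq_of_mul_eq_mul_left (Nat.succ_pos (3 * n))
  rw [Nat.succ_eq_add_one]
  zify at *
  linear_combination (2 * (n : ℤ) + 1) * h - h2

theorem hagenA_two (n : ℕ) :
    (n + 1) * (hagenA n 1 + hagenA n 2) = 2 * Nat.choose (3 * n) n := by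
  have h := hagenA_closed n 2
  have h1 := hagenA_one n
  have h2 := Nat.choose_mul_succ_eq (3 * n) n
  have h3 := Nat.choose_mul_succ_eq (3 * n + 1) n
  have e : 3 * n + 1 - n = 2 * n + 1 := by omega
  have e3 : 3 * n + 1 + 1 - n = 2 * n + 2 := by omega
  rw [e] at h2
  rw [e3] at h3
  rw [add_comm 2 (3 * n)] at h
  have h4 : (2 * n + 1) * (n + 1) * hagenA n 2 = (3 * n + 1) * Nat.choose (3 * n) n := by
    apply Nat.eq_of_mul_eq_mul_left (Nat.succ_pos (3 * n + 1))
    rw [Nat.succ_eq_add_one]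
    zify at *
    linear_combination (2 * (n : ℤ) + 1) * (n + 1) * h - (2 * (n : ℤ) + 1) * h3
      - (3 * (n : ℤ) + 2) * h2
  apply Nat.eq_of_mul_eq_mul_left (Nat.succ_pos (2 * n))
  rw [Nat.succ_eq_add_one]
  zify at *
  linear_combination h4 + ((n : ℤ) + 1) * h1

theorem stmt_3 (z : ℂ) (hz : ‖z‖ < 4 / 27) :
    HasSum (fun n : ℕ => (Nat.choose (3 * n) n : ℂ) * (2 / (n + 1)) * z ^ n)
      (B₃ z + (B₃ z) ^ 2) := by
  have hB : B₃ z = ∑' n : ℕ, (hagenA n 1 : ℂ) * z ^ n := by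
    unfold B₃
    congr 1
    ext n
    have h := hagenA_closed n 1
    rw [add_comm 1 (3 * n)] at h
    have h' : ((3 * n + 1 : ℂ)) * hagenA n 1 = 1 * Nat.choose (3 * n + 1) n := by
      exact_mod_cast h
    have hne : (3 * n + 1 : ℂ) ≠ 0 := by exact_mod_cast Nat.succ_ne_zero (3 * n)
    rw [one_mul] at h'
    rw [← h', mul_div_cancel_left₀ _ hne]
  have hs : Summable (fun n : ℕ => ‖(hagenA n 1 : ℂ) * z ^ n‖) := by
    have hg : Summable (fun n : ℕ => (27 / 4 * ‖z‖) ^ n) :=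
      summable_geometric_of_lt_one (by positivity) (by linarith)
    refine Summable.of_nonneg_of_le (fun n => norm_nonneg _) (fun n => ?_) hg
    rw [norm_mul, norm_pow, mul_pow, Complex.norm_natCast]
    gcongr
    refine le_trans ?_ (choose_bound n)
    rw [← hagenA_one n]
    exact_mod_cast Nat.le_mul_of_pos_left _ (Nat.succ_pos _)
  have h1 : HasSum (fun n : ℕ => (hagenA n 1 : ℂ) * z ^ n) (B₃ z) := by
    rw [hB]; exact hs.of_norm.hasSum
  have hc : ∀ n : ℕ, ∑ p ∈ Finset.HasAntidiagonal.antidiagonal n,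
      ((hagenA p.1 1 : ℂ) * z ^ p.1) * ((hagenA p.2 1 : ℂ) * z ^ p.2)
        = (hagenA n 2 : ℂ) * z ^ n := by
    intro n
    rw [← hagenA_conv n 1 1]
    push_cast
    rw [Finset.sum_mul]
    refine Finset.sum_congr rfl fun p hp => ?_
    rw [← Finset.HasAntidiagonal.mem_antidiagonal.1 hp, pow_add]
    ring
  have h2 : HasSum (fun n : ℕ => (hagenA n 2 : ℂ) * z ^ n) (B₃ z ^ 2) := by
    have hsum := (summable_norm_sum_mul_antidiagonal_of_summable_norm hs hs).of_norm.hasSum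
    rw [← tsum_mul_tsum_eq_tsum_sum_antidiagonal_of_summable_norm hs hs, ← hB, ← sq] at hsum
    simpa only [hc] using hsum
  convert h1.add h2 using 2 with n
  have h := hagenA_two n
  have h' : ((n : ℂ) + 1) * (hagenA n 1 + hagenA n 2) = 2 * Nat.choose (3 * n) n := by
    exact_mod_cast h
  have hne : (n + 1 : ℂ) ≠ 0 := by exact_mod_cast Nat.succ_ne_zero n
  field_simp
  linear_combination -(z ^ n) * h'
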